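/- arXiv:1809.03459 — 3 statements merged into one kernel-verified Lean document; each statement's English description precedes it below -/
import Mathlib

section
/- Define q(z) := p_N''(z)/p_N'(z) for z > 0. Then q is strictly decreasing on (0,∞), q(z) → +∞ as z → 0+, and q(z) → 0 as z → ∞. -/
open MeasureTheory Real Set Filter Topology ProbabilityTheory

/-- The discounted expected cost functional defining `p_N`. -/
noncomputable def pN (N : ℕ) (α : ℝ) (h : ℝ → ℝ) : ℝ → ℝ := fun x =>
  ∫ t in Ioi (0:ℝ), Real.exp (-α * t) *
    ∫ u, h (((N:ℝ) - 1) / N * x + u) ∂(gaussianReal 0 (((N:ℝ) - 1) / N * t).toNNReal)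

/-- Convolving an even function that decreases on `[0, ∞)` with an even integrable density that
decreases on `[0, ∞)` yields a function that decreases on `[0, ∞)`. -/
theorem antitoneOn_integral_mul_add_of_even {φ g : ℝ → ℝ} {B : ℝ} (hφ : Integrable φ)
    (hφe : ∀ x, φ (-x) = φ x) (hφa : AntitoneOn φ (Ici 0)) (hg : Continuous g)
    (hgB : ∀ x, |g x| ≤ B) (hge : ∀ x, g (-x) = g x) (hga : AntitoneOn g (Ici 0)) :
    AntitoneOn (fun x => ∫ u, φ u * g (x + u)) (Ici 0) := by
  have le_of_abs {f : ℝ → ℝ} (he : ∀ x, f (-x) = f x) (ha : AntitoneOn f (Ici 0)) {a b : ℝ}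
      (hab : |a| ≤ |b|) : f b ≤ f a := by
    have habs : ∀ x, f |x| = f x := fun x => by rcases abs_choice x with h | h <;> simp [h, he]
    rw [← habs a, ← habs b]
    exact ha (abs_nonneg a) (abs_nonneg b) hab
  have hint (m d : ℝ) : Integrable (fun w => φ (w + m) * g (w + d)) :=
    (hφ.comp_add_right m).mul_bdd (c := B) (by fun_prop) (ae_of_all _ fun w => hgB _)
  intro x hx y hy hxy
  obtain ⟨m, hm⟩ : ∃ m, m = (x + y) / 2 := ⟨_, rfl⟩
  obtain ⟨d, hd⟩ : ∃ d, d = (y - x) / 2 := ⟨_, rfl⟩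
  have hx0 : 0 ≤ x := hx
  have hm0 : 0 ≤ m := by linarith
  have hd0 : 0 ≤ d := by linarith
  have shift (z : ℝ) :
      ∫ u, φ u * g (z + u) = ∫ w, φ (w + -m) * g (w + (z - m)) := by
    rw [← integral_add_right_eq_self (fun u => φ u * g (z + u)) (-m)]
    congr 1; ext w; congr 2; ring
  have reflect (z : ℝ) :
      ∫ u, φ u * g (z + u) = ∫ w, φ (w + m) * g (w + (m - z)) := by
    rw [shift, ← integral_neg_eq_self]
    congr 1; ext w
    rw [← hφe, ← hge]
    congr 2 <;> ring
  have key : 0 ≤ ∫ w, (φ (w + -m) - φ (w + m)) * (g (w + -d) - g (w + d)) := by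
    refine integral_nonneg fun w => ?_
    rcases le_total 0 w with hw | hw
    · refine mul_nonneg (sub_nonneg.2 (le_of_abs hφe hφa ?_)) (sub_nonneg.2 (le_of_abs hge hga ?_))
      all_goals
        apply sq_le_sq.1
        nlinarith
    · refine mul_nonneg_of_nonpos_of_nonpos (sub_nonpos.2 (le_of_abs hφe hφa ?_))
        (sub_nonpos.2 (le_of_abs hge hga ?_))
      all_goals
        apply sq_le_sq.1
        nlinarith
  have expand : ∫ w, (φ (w + -m) - φ (w + m)) * (g (w + -d) - g (w + d))
      = ((∫ w, φ (w + -m) * g (w + -d)) - ∫ w, φ (w + -m) * g (w + d))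
        + ((∫ w, φ (w + m) * g (w + d)) - ∫ w, φ (w + m) * g (w + -d)) := by
    rw [← integral_sub (hint _ _) (hint _ _), ← integral_sub (hint _ _) (hint _ _),
      ← integral_add (by exact (hint _ _).sub (hint _ _)) (by exact (hint _ _).sub (hint _ _))]
    congr 1; ext w; ring
  have e1 := shift x
  have e2 := shift y
  have e3 := reflect x
  have e4 := reflect y
  rw [show x - m = -d by linarith] at e1
  rw [show y - m = d by linarith] at e2
  rw [show m - x = d by linarith] at e3
  rw [show m - y = -d by linarith] at e4
  rw [expand, ← e1, ← e2, ← e3, ← e4] at key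
  change ∫ u, φ u * g (y + u) ≤ ∫ u, φ u * g (x + u)
  linarith

/-- Averaging an even function that decreases on `[0, ∞)` over a standard Gaussian shift preserves
monotonicity on `[0, ∞)`. -/
theorem antitoneOn_integral_add_gaussianReal {g : ℝ → ℝ} {B : ℝ} (hg : Continuous g)
    (hgB : ∀ x, |g x| ≤ B) (hge : ∀ x, g (-x) = g x) (hga : AntitoneOn g (Ici 0)) :
    AntitoneOn (fun x => ∫ u, g (x + u) ∂gaussianReal 0 1) (Ici 0) := by
  simp_rw [integral_gaussianReal_eq_integral_smul one_ne_zero, smul_eq_mul]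
  refine antitoneOn_integral_mul_add_of_even (integrable_gaussianPDFReal 0 1) ?_ ?_ hg hgB hge hga
  · intro x
    simp [gaussianPDFReal]
  · intro x hx y hy hxy
    have hx0 : 0 ≤ x := hx
    simp only [gaussianPDFReal, sub_zero]
    gcongr

/-- A centered Gaussian average as a rescaled standard Gaussian average. -/
theorem integral_gaussianReal_toNNReal {f : ℝ → ℝ} (hf : Continuous f) {v : ℝ} (hv : 0 ≤ v) :
    ∫ u, f u ∂gaussianReal 0 v.toNNReal = ∫ z, f (√v * z) ∂gaussianReal 0 1 := by
  have hmap : gaussianReal 0 v.toNNReal = (gaussianReal 0 1).map (√v * ·) := by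
    rw [gaussianReal_map_const_mul]
    congr 1
    · simp
    · ext
      simp [Real.sq_sqrt hv, hv]
  rw [hmap, integral_map (by fun_prop) hf.aestronglyMeasurable]

/-- The product of Lebesgue measure on `(0, ∞)` and the standard Gaussian measure. -/
noncomputable def timeGaussian : Measure (ℝ × ℝ) :=
  (volume.restrict (Ioi (0 : ℝ))).prod (gaussianReal 0 1)

/-- The discounted average of `f` along a Brownian motion run at speed `c` and started
at `c * x`. -/
noncomputable def discountedAverage (c α : ℝ) (f : ℝ → ℝ) (x : ℝ) : ℝ :=
  ∫ p, rexp (-α * p.1) * f (c * x + √(c * p.1) * p.2) ∂timeGaussian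

theorem ae_timeGaussian_fst_pos : ∀ᵐ p ∂timeGaussian, 0 < p.1 := by
  have h : ∀ᵐ t ∂(volume.restrict (Ioi (0 : ℝ))), 0 < t := ae_restrict_mem measurableSet_Ioi
  exact Measure.quasiMeasurePreserving_fst.ae h

theorem integrable_discount {α : ℝ} (hα : 0 < α) :
    Integrable (fun p : ℝ × ℝ => rexp (-α * p.1)) timeGaussian := by
  have h := Integrable.mul_prod (exp_neg_integrableOn_Ioi 0 hα)
    (integrable_const (1 : ℝ) (μ := gaussianReal 0 1))
  simpa [timeGaussian] using h

theorem integrable_discount_mul_sq {α : ℝ} (hα : 0 < α) :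
    Integrable (fun p : ℝ × ℝ => rexp (-α * p.1) * (p.1 * p.2 ^ 2)) timeGaussian := by
  have h1 : IntegrableOn (fun t : ℝ => rexp (-α * t) * t) (Ioi 0) := by
    have := integrableOn_rpow_mul_exp_neg_mul_rpow (p := 1) (s := 1) (by norm_num) one_pos hα
    simpa [mul_comm] using this
  have h2 : Integrable (fun z : ℝ => z ^ 2) (gaussianReal 0 1) := by
    simpa using (memLp_id_gaussianReal (μ := 0) (v := 1) 2).integrable_sq
  have h := Integrable.mul_prod h1 h2
  simpa [timeGaussian, mul_assoc] using h

theorem integral_discount {α : ℝ} (hα : 0 < α) :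
    ∫ p, rexp (-α * p.1) ∂timeGaussian = 1 / α := by
  have h := integral_prod_mul (μ := volume.restrict (Ioi (0 : ℝ))) (ν := gaussianReal 0 1)
    (fun t : ℝ => rexp (-α * t)) (fun _ => (1 : ℝ))
  rw [integral_exp_mul_Ioi (neg_neg_of_pos hα)] at h
  simpa [timeGaussian] using h

/-- A locally uniform bound on the integrand of `discountedAverage`. -/
theorem abs_discounted_le {c α A : ℝ} (hc0 : 0 ≤ c) (hc1 : c ≤ 1) {f : ℝ → ℝ}
    (hf : ∀ x, |f x| ≤ A * (1 + x ^ 2)) {x r : ℝ} (hx : |x| ≤ r) {p : ℝ × ℝ} (hp : 0 < p.1) :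
    |rexp (-α * p.1) * f (c * x + √(c * p.1) * p.2)|
      ≤ (A * (1 + 2 * r ^ 2)) * rexp (-α * p.1)
        + (2 * A) * (rexp (-α * p.1) * (p.1 * p.2 ^ 2)) := by
  have hA : 0 ≤ A := by simpa using (abs_nonneg _).trans (hf 0)
  have hsq : √(c * p.1) ^ 2 = c * p.1 := Real.sq_sqrt (by positivity)
  have hxr : x ^ 2 ≤ r ^ 2 := sq_le_sq' (by linarith [(abs_le.1 hx).1]) (abs_le.1 hx).2
  have h1 : (c * x) ^ 2 ≤ r ^ 2 := by
    calc (c * x) ^ 2 = c ^ 2 * x ^ 2 := by ring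
      _ ≤ 1 * x ^ 2 := by gcongr; exact pow_le_one₀ hc0 hc1
      _ ≤ r ^ 2 := by linarith
  have h2 : (√(c * p.1) * p.2) ^ 2 ≤ p.1 * p.2 ^ 2 := by
    calc (√(c * p.1) * p.2) ^ 2 = c * (p.1 * p.2 ^ 2) := by rw [mul_pow, hsq]; ring
      _ ≤ 1 * (p.1 * p.2 ^ 2) := by gcongr
      _ = _ := one_mul _
  have h3 : (c * x + √(c * p.1) * p.2) ^ 2 ≤ 2 * r ^ 2 + 2 * (p.1 * p.2 ^ 2) :=
    add_sq_le.trans (by linarith)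
  rw [abs_mul, abs_of_pos (Real.exp_pos _)]
  calc rexp (-α * p.1) * |f (c * x + √(c * p.1) * p.2)|
      ≤ rexp (-α * p.1) * (A * (1 + (2 * r ^ 2 + 2 * (p.1 * p.2 ^ 2)))) := by
        gcongr
        exact (hf _).trans (by gcongr)
    _ = _ := by ring

theorem integrable_discounted {c α A : ℝ} (hc0 : 0 ≤ c) (hc1 : c ≤ 1) (hα : 0 < α) {f : ℝ → ℝ}
    (hfc : Continuous f) (hf : ∀ x, |f x| ≤ A * (1 + x ^ 2)) (x : ℝ) :
    Integrable (fun p : ℝ × ℝ => rexp (-α * p.1) * f (c * x + √(c * p.1) * p.2))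
      timeGaussian := by
  refine Integrable.mono' (((integrable_discount hα).const_mul (A * (1 + 2 * |x| ^ 2))).add
    ((integrable_discount_mul_sq hα).const_mul (2 * A)))
    (Continuous.aestronglyMeasurable (by fun_prop)) ?_
  filter_upwards [ae_timeGaussian_fst_pos] with p hp
  exact abs_discounted_le hc0 hc1 hf le_rfl hp

theorem hasDerivAt_discountedAverage {c α A : ℝ} (hc0 : 0 ≤ c) (hc1 : c ≤ 1) (hα : 0 < α)
    {f f' : ℝ → ℝ} (hff' : ∀ x, HasDerivAt f (f' x) x) (hfc' : Continuous f')
    (hf : ∀ x, |f x| ≤ A * (1 + x ^ 2)) (hf' : ∀ x, |f' x| ≤ A * (1 + x ^ 2)) (x : ℝ) :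
    HasDerivAt (discountedAverage c α f) (c * discountedAverage c α f' x) x := by
  have hfc : Continuous f := continuous_iff_continuousAt.2 fun x => (hff' x).continuousAt
  have h := hasDerivAt_integral_of_dominated_loc_of_deriv_le (μ := timeGaussian)
    (F := fun x p => rexp (-α * p.1) * f (c * x + √(c * p.1) * p.2))
    (F' := fun x p => c * (rexp (-α * p.1) * f' (c * x + √(c * p.1) * p.2)))
    (bound := fun p => (A * (1 + 2 * (|x| + 1) ^ 2)) * rexp (-α * p.1)
        + (2 * A) * (rexp (-α * p.1) * (p.1 * p.2 ^ 2)))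
    (Metric.ball_mem_nhds x one_pos)
    (Eventually.of_forall fun y => (integrable_discounted hc0 hc1 hα hfc hf y).1)
    (integrable_discounted hc0 hc1 hα hfc hf x)
    ((integrable_discounted hc0 hc1 hα hfc' hf' x).const_mul c).1 ?_
    (((integrable_discount hα).const_mul _).add ((integrable_discount_mul_sq hα).const_mul _)) ?_
  · have h2 := h.2
    rw [integral_const_mul] at h2
    exact h2
  · filter_upwards [ae_timeGaussian_fst_pos] with p hp y hy
    have hy' : |y| ≤ |x| + 1 := by
      have h1 : |y - x| < 1 := by simpa [Real.dist_eq] using hy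
      have h2 := abs_sub_abs_le_abs_sub y x
      linarith
    rw [Real.norm_eq_abs, abs_mul, abs_of_nonneg hc0]
    exact (mul_le_of_le_one_left (abs_nonneg _) hc1).trans (abs_discounted_le hc0 hc1 hf' hy' hp)
  · refine ae_of_all _ fun p y _ => ?_
    have h1 : HasDerivAt (fun y => c * y + √(c * p.1) * p.2) c y := by
      simpa using ((hasDerivAt_id y).const_mul c).add_const (√(c * p.1) * p.2)
    have h2 := ((hff' _).comp y h1).const_mul (rexp (-α * p.1))
    exact h2.congr_deriv (by ring)

theorem discountedAverage_eq_iterated {c α A : ℝ} (hc0 : 0 ≤ c) (hc1 : c ≤ 1) (hα : 0 < α)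
    {f : ℝ → ℝ} (hfc : Continuous f) (hf : ∀ x, |f x| ≤ A * (1 + x ^ 2)) (x : ℝ) :
    discountedAverage c α f x = ∫ t in Ioi (0 : ℝ), rexp (-α * t) *
      ∫ z, f (c * x + √(c * t) * z) ∂gaussianReal 0 1 := by
  rw [discountedAverage, timeGaussian, integral_prod _ (integrable_discounted hc0 hc1 hα hfc hf x)]
  simp only [integral_const_mul]

theorem discountedAverage_zero_of_odd {c α A : ℝ} (hc0 : 0 ≤ c) (hc1 : c ≤ 1) (hα : 0 < α)
    {f : ℝ → ℝ} (hfc : Continuous f) (hf : ∀ x, |f x| ≤ A * (1 + x ^ 2))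
    (hodd : ∀ x, f (-x) = -f x) : discountedAverage c α f 0 = 0 := by
  rw [discountedAverage_eq_iterated hc0 hc1 hα hfc hf]
  have hz (t : ℝ) : ∫ z, f (c * 0 + √(c * t) * z) ∂gaussianReal 0 1 = 0 := by
    have hneg : (gaussianReal 0 1).map (fun z => -z) = gaussianReal 0 1 := by
      simpa using gaussianReal_map_neg (μ := 0) (v := 1)
    have h : ∫ z, f (c * 0 + √(c * t) * z) ∂gaussianReal 0 1
        = -∫ z, f (c * 0 + √(c * t) * z) ∂gaussianReal 0 1 := by
      conv_lhs => rw [← hneg]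
      rw [integral_map (by fun_prop) (Continuous.aestronglyMeasurable (by fun_prop)),
        ← integral_neg]
      congr 1; ext z
      rw [← hodd]
      congr 1; ring
    linarith
  simp_rw [hz]
  simp

theorem antitoneOn_discountedAverage {c α A : ℝ} (hc0 : 0 < c) (hc1 : c ≤ 1) (hα : 0 < α)
    {g : ℝ → ℝ} (hg : Continuous g) (hgA : ∀ x, |g x| ≤ A) (hge : ∀ x, g (-x) = g x)
    (hga : AntitoneOn g (Ici 0)) : AntitoneOn (discountedAverage c α g) (Ici 0) := by
  have hA : 0 ≤ A := (abs_nonneg _).trans (hgA 0)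
  have hgA' : ∀ x, |g x| ≤ A * (1 + x ^ 2) := fun x => (hgA x).trans (by nlinarith [sq_nonneg x])
  intro x hx y hy hxy
  have hx0 : 0 ≤ x := hx
  have hint (x : ℝ) := (integrable_discounted hc0.le hc1 hα hg hgA' x).integral_prod_left
  simp only [integral_const_mul] at hint
  rw [discountedAverage_eq_iterated hc0.le hc1 hα hg hgA',
    discountedAverage_eq_iterated hc0.le hc1 hα hg hgA']
  refine setIntegral_mono_on (hint y) (hint x) measurableSet_Ioi fun t ht => ?_
  have ht0 : 0 < t := ht
  have hs : 0 < √(c * t) := Real.sqrt_pos.2 (by positivity)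
  refine mul_le_mul_of_nonneg_left ?_ (Real.exp_pos _).le
  have hanti := antitoneOn_integral_add_gaussianReal (g := fun u => g (√(c * t) * u)) (B := A)
    (by fun_prop) (fun _ => hgA _) (fun u => by rw [mul_neg, hge])
    (fun a ha b hb hab => hga (mul_nonneg hs.le ha) (mul_nonneg hs.le hb) (by gcongr))
  have hcomp (w : ℝ) : ∫ z, g (c * w + √(c * t) * z) ∂gaussianReal 0 1
      = ∫ z, g (√(c * t) * (c * w / √(c * t) + z)) ∂gaussianReal 0 1 := by
    congr 1; ext z
    rw [mul_add, mul_div_cancel₀ _ hs.ne']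
  rw [hcomp, hcomp]
  have hy0 : 0 ≤ y := hx0.trans hxy
  exact hanti (mem_Ici.2 (by positivity)) (mem_Ici.2 (by positivity)) (by gcongr)

theorem discountedAverage_mem_Icc {c α k K A : ℝ} (hc0 : 0 ≤ c) (hc1 : c ≤ 1) (hα : 0 < α)
    {g : ℝ → ℝ} (hg : Continuous g) (hgA : ∀ x, |g x| ≤ A * (1 + x ^ 2)) (hk : ∀ x, k ≤ g x)
    (hK : ∀ x, g x ≤ K) (x : ℝ) : discountedAverage c α g x ∈ Icc (k / α) (K / α) := by
  have hint := integrable_discounted hc0 hc1 hα hg hgA x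
  have hconst (a : ℝ) : ∫ p, rexp (-α * p.1) * a ∂timeGaussian = a / α := by
    rw [integral_mul_const, integral_discount hα]; ring
  constructor
  · rw [← hconst k]
    exact integral_mono ((integrable_discount hα).mul_const k) hint fun p =>
      mul_le_mul_of_nonneg_left (hk _) (Real.exp_pos _).le
  · rw [← hconst K]
    exact integral_mono hint ((integrable_discount hα).mul_const K) fun p =>
      mul_le_mul_of_nonneg_left (hK _) (Real.exp_pos _).le

/-- The logarithmic derivative of a function vanishing at `0` whose derivative is positive, bounded
above and below, and decreasing on `[0, ∞)`. -/
theorem logDeriv_properties_of_antitoneOn_deriv {F S : ℝ → ℝ} {a b : ℝ} (ha : 0 < a)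
    (hF : ∀ x, HasDerivAt F (S x) x) (hF0 : F 0 = 0) (hS : ∀ x, S x ∈ Icc a b)
    (hSa : AntitoneOn S (Ici 0)) :
    StrictAntiOn (fun z => S z / F z) (Ioi 0) ∧
    Tendsto (fun z => S z / F z) (𝓝[>] 0) atTop ∧
    Tendsto (fun z => S z / F z) atTop (𝓝 0) := by
  have hFmono : StrictMono F := strictMono_of_hasDerivAt_pos hF fun x => ha.trans_le (hS x).1
  have hFpos : ∀ z, 0 < z → 0 < F z := fun z hz => hF0 ▸ hFmono hz
  have hFlin : ∀ z, 0 ≤ z → a * z ≤ F z := by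
    have hmono : Monotone fun z => F z - a * z :=
      monotone_of_hasDerivAt_nonneg
        (fun x => (hF x).sub ((hasDerivAt_id x).const_mul a))
        (fun x => by simpa using (hS x).1)
    intro z hz
    have := hmono hz
    simp only [hF0, mul_zero, sub_zero] at this
    linarith
  refine ⟨?_, ?_, ?_⟩
  · intro x hx y hy hxy
    have hx0 : 0 < x := hx
    exact div_lt_div₀' (hSa hx0.le (hx0.trans hxy).le hxy.le) (hFmono hxy)
      (ha.trans_le (hS x).1) (hFpos x hx)
  · have hF0' : Tendsto F (𝓝[>] 0) (𝓝[>] 0) := by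
      refine tendsto_nhdsWithin_iff.2 ⟨?_, ?_⟩
      · have := (hF 0).continuousAt.tendsto
        rw [hF0] at this
        exact this.mono_left nhdsWithin_le_nhds
      · filter_upwards [self_mem_nhdsWithin] with z hz using hFpos z hz
    refine tendsto_atTop_mono' _ ?_ ((tendsto_inv_nhdsGT_zero.comp hF0').const_mul_atTop ha)
    filter_upwards [self_mem_nhdsWithin] with z hz
    rw [div_eq_mul_inv]
    exact mul_le_mul_of_nonneg_right (hS z).1 (inv_nonneg.2 (hFpos z hz).le)
  · have hlim : Tendsto (fun z => b / (a * z)) atTop (𝓝 0) :=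
      tendsto_const_nhds.div_atTop (tendsto_id.const_mul_atTop ha)
    refine squeeze_zero' ?_ ?_ hlim
    · filter_upwards [eventually_gt_atTop 0] with z hz
      exact div_nonneg (ha.le.trans (hS z).1) (hFpos z hz).le
    · filter_upwards [eventually_gt_atTop 0] with z hz
      have hb : 0 ≤ b := ha.le.trans ((hS 0).1.trans (hS 0).2)
      exact div_le_div₀ hb (hS z).2 (by positivity) (hFlin z hz.le)

theorem deriv_odd_of_even {f : ℝ → ℝ} (hf : ∀ x, f (-x) = f x) (x : ℝ) :
    deriv f (-x) = -deriv f x := by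
  have h := deriv_comp_neg f x
  simp only [hf] at h
  linarith

theorem deriv_even_of_odd {f : ℝ → ℝ} (hf : ∀ x, f (-x) = -f x) (x : ℝ) :
    deriv f (-x) = deriv f x := by
  have h := deriv_comp_neg f x
  simp only [hf, deriv.fun_neg] at h
  linarith

/-- Under H2', `q(z) = p_N''(z)/p_N'(z)` is strictly decreasing on `(0,∞)`,
`q(z) → +∞` as `z → 0+` and `q(z) → 0` as `z → ∞`. -/
theorem q_ratio_properties (N : ℕ) (hN : 2 ≤ N) (α k K : ℝ) (hα : 0 < α)
    (hk : 0 < k) (hkK : k < K) (h : ℝ → ℝ) (hC2 : ContDiff ℝ 2 h)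
    (heven : ∀ x, h (-x) = h x) (h0 : 0 ≤ h 0)
    (hmono : AntitoneOn (deriv (deriv h)) (Set.Ici 0))
    (hlb : ∀ x, k ≤ deriv (deriv h) x) (hub : ∀ x, deriv (deriv h) x ≤ K)
    (q : ℝ → ℝ)
    (hq : q = fun z => deriv (deriv (pN N α h)) z / deriv (pN N α h) z) :
    StrictAntiOn q (Set.Ioi 0) ∧
    Tendsto q (𝓝[>] 0) atTop ∧
    Tendsto q atTop (𝓝 0) := by
  obtain ⟨c, hc⟩ : ∃ c : ℝ, c = ((N : ℝ) - 1) / N := ⟨_, rfl⟩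
  have hN2 : (2 : ℝ) ≤ N := by exact_mod_cast hN
  have hc0 : 0 < c := hc ▸ div_pos (by linarith) (by linarith)
  have hc1 : c ≤ 1 := hc ▸ div_le_one_of_le₀ (by linarith) (by linarith)
  have hK : 0 < K := hk.trans hkK
  have hC1 : ContDiff ℝ 1 (deriv h) := by
    have : ContDiff ℝ (1 + 1) h := by simpa [one_add_one_eq_two] using hC2
    exact (contDiff_succ_iff_deriv.1 this).2.2
  have hd1 : ∀ x, HasDerivAt h (deriv h x) x := fun x =>
    (hC2.differentiable (by norm_num) x).hasDerivAt
  have hd2 : ∀ x, HasDerivAt (deriv h) (deriv (deriv h) x) x := fun x =>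
    (hC1.differentiable (by norm_num) x).hasDerivAt
  have hcont2 : Continuous (deriv (deriv h)) := hC1.continuous_deriv le_rfl
  have hodd := deriv_odd_of_even heven
  have hd0 : deriv h 0 = 0 := by
    have := hodd 0
    rw [neg_zero] at this
    linarith
  have habs2 : ∀ x, |deriv (deriv h) x| ≤ K := fun x =>
    abs_le.2 ⟨by linarith [hlb x], hub x⟩
  have habs1 : ∀ x, |deriv h x| ≤ K * |x| := fun x => by
    have := convex_univ.norm_image_sub_le_of_norm_hasDerivWithin_le (f := deriv h)
      (fun y _ => (hd2 y).hasDerivWithinAt) (fun y _ => habs2 y) (mem_univ 0) (mem_univ x)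
    simpa [hd0] using this
  have habs0 : ∀ x, |h x - h 0| ≤ K * |x| * |x| := fun x => by
    have := (convex_uIcc 0 x).norm_image_sub_le_of_norm_hasDerivWithin_le (f := h) (C := K * |x|)
      (fun y _ => (hd1 y).hasDerivWithinAt) (fun y hy => (habs1 y).trans ?_) left_mem_uIcc
      right_mem_uIcc
    · simpa using this
    · have : |y| ≤ |x| := by simpa using abs_sub_left_of_mem_uIcc hy
      gcongr
  obtain ⟨A, hA⟩ : ∃ A, A = h 0 + K := ⟨_, rfl⟩
  have hb0 : ∀ x, |h x| ≤ A * (1 + x ^ 2) := fun x => by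
    have h1 := habs0 x
    rw [mul_assoc, abs_mul_abs_self] at h1
    have h2 := abs_le.1 h1
    rw [hA]
    exact abs_le.2 ⟨by nlinarith [sq_nonneg x], by nlinarith [sq_nonneg x]⟩
  have hb1 : ∀ x, |deriv h x| ≤ A * (1 + x ^ 2) := fun x => by
    have h1 := habs1 x
    have h2 : |x| ≤ 1 + x ^ 2 := by nlinarith [sq_abs x, sq_nonneg (|x| - 1)]
    calc |deriv h x| ≤ K * (1 + x ^ 2) := h1.trans (by gcongr)
      _ ≤ A * (1 + x ^ 2) := by gcongr; linarith
  have hb2 : ∀ x, |deriv (deriv h) x| ≤ A * (1 + x ^ 2) := fun x => by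
    have h1 := habs2 x
    nlinarith [sq_nonneg x]
  have hp : pN N α h = discountedAverage c α h := by
    ext x
    rw [discountedAverage_eq_iterated hc0.le hc1 hα hC2.continuous hb0, pN, ← hc]
    refine setIntegral_congr_fun measurableSet_Ioi fun t ht => ?_
    have ht0 : 0 < t := ht
    have hh := hC2.continuous
    rw [integral_gaussianReal_toNNReal (f := fun u => h (c * x + u)) (by fun_prop) (by positivity)]
  have hD1 : deriv (pN N α h) = fun x => c * discountedAverage c α (deriv h) x := by
    ext x
    rw [hp]
    exact (hasDerivAt_discountedAverage hc0.le hc1 hα hd1 hC1.continuous hb0 hb1 x).deriv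
  have hF : ∀ x, HasDerivAt (fun x => c * discountedAverage c α (deriv h) x)
      (c * (c * discountedAverage c α (deriv (deriv h)) x)) x := fun x =>
    (hasDerivAt_discountedAverage hc0.le hc1 hα hd2 hcont2 hb1 hb2 x).const_mul c
  have hD2 : deriv (deriv (pN N α h)) =
      fun x => c * (c * discountedAverage c α (deriv (deriv h)) x) := by
    rw [hD1]
    exact funext fun x => (hF x).deriv
  rw [hq, hD2, hD1]
  refine logDeriv_properties_of_antitoneOn_deriv (a := c * (c * (k / α))) (b := c * (c * (K / α)))
    (by positivity) hF ?_ (fun x => ?_) ?_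
  · rw [discountedAverage_zero_of_odd hc0.le hc1 hα hC1.continuous hb1 hodd, mul_zero]
  · have hm := discountedAverage_mem_Icc hc0.le hc1 hα hcont2 hb2 hlb hub x
    constructor
    · have := hm.1
      gcongr
    · have := hm.2
      gcongr
  · intro x hx y hy hxy
    have := antitoneOn_discountedAverage hc0 hc1 hα hcont2 habs2 (deriv_even_of_odd hodd) hmono
      hx hy hxy
    simp only
    gcongr
end

section
/- There exists a unique z > 0 such that β·tanh(β·z) = p_N''(z)/p_N'(z), where β = √(2(N−1)α/N). That is, the free-boundary intercept equation √(2(N−1)α/N)·tanh(z·√(2(N−1)α/N)) = p_N''(z)/p_N'(z) (equation (4.13)) has a unique positive root x₀. -/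
open MeasureTheory Real Set Filter Topology ProbabilityTheory

/-- A differentiable function whose derivative grows at most linearly can be differentiated under
the expectation of an integrable random translation. -/
lemma hasDerivAt_integral_comp_add {Ω : Type*} [MeasurableSpace Ω] {ρ : Measure Ω}
    [IsFiniteMeasure ρ] {X : Ω → ℝ} (hX : Measurable X) (hXi : Integrable X ρ) {f : ℝ → ℝ}
    (hf : ContDiff ℝ 1 f) {A : ℝ} (hA : ∀ y, |deriv f y| ≤ A * (1 + |y|))
    (hfi : ∀ y, Integrable (fun ω => f (y + X ω)) ρ) (y : ℝ) :
    HasDerivAt (fun y => ∫ ω, f (y + X ω) ∂ρ) (∫ ω, deriv f (y + X ω) ∂ρ) y := by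
  have hA0 : 0 ≤ A := by simpa using (abs_nonneg _).trans (hA 0)
  have hf' : Continuous (deriv f) := hf.continuous_deriv le_rfl
  refine (hasDerivAt_integral_of_dominated_loc_of_deriv_le (F := fun y ω => f (y + X ω))
    (F' := fun y ω => deriv f (y + X ω)) (bound := fun ω => A * (1 + (|y| + 1 + |X ω|)))
    (Metric.ball_mem_nhds y one_pos) (Eventually.of_forall fun x => (hfi x).aestronglyMeasurable)
    (hfi y) ?_ ?_ ?_ ?_).2
  · exact (hf'.measurable.comp (measurable_const.add hX)).aestronglyMeasurable
  · refine Eventually.of_forall fun ω x hx => (hA _).trans ?_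
    have h1 : |x - y| < 1 := hx
    have h2 : |x + X ω| ≤ |y| + 1 + |X ω| := by
      have := abs_add_le x (X ω)
      have := abs_sub_abs_le_abs_sub x y
      linarith
    gcongr
  · fun_prop
  · refine Eventually.of_forall fun ω x _ => ?_
    have := ((hf.differentiable one_ne_zero) (x + X ω)).hasDerivAt
    simpa using this.comp_add_const x (X ω)

/-- Averaging an even function that is antitone on the half-line against a centered Gaussian
preserves antitonicity on the half-line. -/
lemma antitoneOn_integral_gaussianReal {H : ℝ → ℝ} (hHc : Continuous H) {C : ℝ}
    (hC : ∀ y, |H y| ≤ C) (heven : ∀ y, H (-y) = H y) (hanti : AntitoneOn H (Ici 0))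
    (v : NNReal) :
    AntitoneOn (fun y => ∫ u, H (y + u) ∂(gaussianReal 0 v)) (Ici 0) := by
  intro a ha b hb hab
  rcases eq_or_ne v 0 with rfl | hv
  · simpa using hanti ha hb hab
  have ha' : 0 ≤ a := ha
  have habs : ∀ x, H |x| = H x := fun x => by
    rcases abs_choice x with hx | hx <;> rw [hx]
    exact heven x
  have hle : ∀ x y, |x| ≤ |y| → H y ≤ H x := fun x y hxy => by
    rw [← habs x, ← habs y]
    exact hanti (abs_nonneg x) (abs_nonneg y) hxy
  set g := gaussianPDFReal 0 v with hg
  have hg_int : Integrable g := integrable_gaussianPDFReal 0 v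
  have hg_even : ∀ s, g (-s) = g s := fun s => by simp [hg, gaussianPDFReal]
  have hg_le : ∀ x y, |x| ≤ |y| → g y ≤ g x := fun x y hxy => by
    have := sq_le_sq.2 hxy
    simp only [hg, gaussianPDFReal, sub_zero]
    gcongr
  have hint : ∀ y d : ℝ, Integrable (fun s => g (s + d) * H (y + s)) := fun y d =>
    (hg_int.comp_add_right d).mul_bdd (c := C)
      (hHc.comp (continuous_const.add continuous_id)).aestronglyMeasurable
      (Eventually.of_forall fun s => hC _)
  have hint' : ∀ y d : ℝ, Integrable (fun s => g (s + d) * H (y - s)) := fun y d =>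
    (hg_int.comp_add_right d).mul_bdd (c := C)
      (hHc.comp (continuous_const.sub continuous_id)).aestronglyMeasurable
      (Eventually.of_forall fun s => hC _)
  obtain ⟨m, d, rfl, rfl⟩ : ∃ m d, a = m - d ∧ b = m + d :=
    ⟨(a + b) / 2, (b - a) / 2, by ring, by ring⟩
  have hd : 0 ≤ d := by linarith
  have hm : 0 ≤ m := by linarith
  have key : ∀ e : ℝ, ∫ u, H (m + e + u) ∂(gaussianReal 0 v) = ∫ s, g (s + -e) * H (m + s) := by
    intro e
    rw [integral_gaussianReal_eq_integral_smul hv,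
      ← integral_sub_right_eq_self (fun u => gaussianPDFReal 0 v u • H (m + e + u)) e]
    refine integral_congr_ae (Eventually.of_forall fun s => ?_)
    simp only [smul_eq_mul, ← sub_eq_add_neg]
    congr 2
    ring
  have key' : ∀ e : ℝ, ∫ s, g (s + -e) * H (m + s) = ∫ s, g (s + e) * H (m - s) := by
    intro e
    rw [← integral_neg_eq_self]
    refine integral_congr_ae (Eventually.of_forall fun s => ?_)
    simp only [← sub_eq_add_neg]
    rw [← hg_even, neg_sub, sub_neg_eq_add, add_comm e]
  have e1 := key d
  have e2 := key (-d)
  have e3 := key' d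
  have e4 := key' (-d)
  simp only [neg_neg, ← sub_eq_add_neg] at e1 e2 e3 e4
  change ∫ u, H (m + d + u) ∂(gaussianReal 0 v) ≤ ∫ u, H (m - d + u) ∂(gaussianReal 0 v)
  have hpos : 0 ≤ ∫ s, (g (s + d) * H (m + s) - g (s + -d) * H (m + s))
      + (g (s + -d) * H (m - s) - g (s + d) * H (m - s)) := by
    refine integral_nonneg fun s => ?_
    have : (g (s + d) * H (m + s) - g (s + -d) * H (m + s))
      + (g (s + -d) * H (m - s) - g (s + d) * H (m - s))
      = (g (s + d) - g (s + -d)) * (H (m + s) - H (m - s)) := by ring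
    simp only [this, Pi.zero_apply]
    rcases le_total 0 s with hs | hs
    · refine mul_nonneg_of_nonpos_of_nonpos (sub_nonpos.2 (hg_le _ _ ?_))
        (sub_nonpos.2 (hle _ _ ?_)) <;> rw [← sq_le_sq] <;>
          nlinarith [mul_nonneg hs hd, mul_nonneg hs hm]
    · refine mul_nonneg (sub_nonneg.2 (hg_le _ _ ?_))
        (sub_nonneg.2 (hle _ _ ?_)) <;> rw [← sq_le_sq] <;>
          nlinarith [mul_nonneg (neg_nonneg.2 hs) hd, mul_nonneg (neg_nonneg.2 hs) hm]
  have i1 : Integrable fun s => g (s + d) * H (m + s) - g (s + -d) * H (m + s) :=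
    (hint _ _).sub (hint _ _)
  have i2 : Integrable fun s => g (s + -d) * H (m - s) - g (s + d) * H (m - s) :=
    (hint' _ _).sub (hint' _ _)
  rw [integral_add i1 i2,
    integral_sub (hint _ _) (hint _ _), integral_sub (hint' _ _) (hint' _ _)] at hpos
  simp only [← sub_eq_add_neg] at hpos
  linarith

lemma integral_gaussianReal_eq_integral_standard {v : ℝ} (hv : 0 ≤ v) {f : ℝ → ℝ}
    (hf : Continuous f) :
    ∫ u, f u ∂(gaussianReal 0 v.toNNReal) = ∫ z, f (√v * z) ∂(gaussianReal 0 1) := by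
  have hmap : (gaussianReal 0 1).map (fun x => √v * x) = gaussianReal 0 v.toNNReal := by
    rw [gaussianReal_map_const_mul, mul_zero, mul_one]
    congr 1
    ext
    simp [Real.sq_sqrt hv, hv]
  rw [← hmap, integral_map (by fun_prop) hf.aestronglyMeasurable]

lemma integral_gaussianReal_neg_add {h : ℝ → ℝ} (hc : Continuous h) (heven : ∀ x, h (-x) = h x)
    (v : NNReal) (y : ℝ) :
    ∫ u, h (-y + u) ∂(gaussianReal 0 v) = ∫ u, h (y + u) ∂(gaussianReal 0 v) := by
  have hmap : (gaussianReal 0 v).map (fun x => -x) = gaussianReal 0 v := by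
    rw [gaussianReal_map_neg, neg_zero]
  conv_lhs => rw [← hmap]
  rw [integral_map (by fun_prop) (by fun_prop)]
  refine integral_congr_ae (Eventually.of_forall fun u => ?_)
  simp only
  rw [← heven]
  congr 1
  ring

lemma abs_le_mul_abs_of_abs_deriv_le {f : ℝ → ℝ} (hf : Differentiable ℝ f) {K r y : ℝ}
    (hK : ∀ x, |x| ≤ r → |deriv f x| ≤ K) (hy : |y| ≤ r) : |f y - f 0| ≤ K * |y| := by
  have := (convex_closedBall (0 : ℝ) r).norm_image_sub_le_of_norm_deriv_le (𝕜 := ℝ) (f := f)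
    (x := 0) (y := y) (C := K) (fun x _ => hf x) (fun x hx => hK x (by simpa using hx))
    (by simpa using (abs_nonneg y).trans hy) (by simpa using hy)
  simpa using this

lemma strictMono_tanh : StrictMono Real.tanh := by
  intro a b hab
  rw [Real.tanh_eq_sinh_div_cosh, Real.tanh_eq_sinh_div_cosh,
    div_lt_div_iff₀ (Real.cosh_pos a) (Real.cosh_pos b)]
  have h1 : 0 < Real.sinh (b - a) := Real.sinh_pos_iff.2 (sub_pos.2 hab)
  rw [Real.sinh_sub] at h1
  linarith

lemma continuous_tanh : Continuous Real.tanh := by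
  have : Real.tanh = fun x => Real.sinh x / Real.cosh x := funext Real.tanh_eq_sinh_div_cosh
  rw [this]
  exact Real.continuous_sinh.div Real.continuous_cosh fun x => (Real.cosh_pos x).ne'

/-- If `P` vanishes at `0` and `P'` is continuous, bounded below by a positive constant and antitone
on the half-line, then `β tanh (β z) = P'(z) / P(z)` has a unique positive root. -/
lemma existsUnique_tanh_eq_deriv_div {P P' : ℝ → ℝ} {β m : ℝ} (hβ : 0 < β) (hm : 0 < m)
    (hP : ∀ x, HasDerivAt P (P' x) x) (hP0 : P 0 = 0) (hP'c : Continuous P')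
    (hP'm : ∀ x, m ≤ P' x) (hP'a : AntitoneOn P' (Ici 0)) :
    ∃! z : ℝ, 0 < z ∧ β * Real.tanh (β * z) = P' z / P z := by
  have hmono : StrictMono P :=
    strictMono_of_hasDerivAt_pos hP fun x => hm.trans_le (hP'm x)
  have hPpos : ∀ z, 0 < z → 0 < P z := fun z hz => hP0 ▸ hmono hz
  have hgrow : ∀ z, 0 ≤ z → m * z ≤ P z := fun z hz => by
    have := mul_sub_le_image_sub_of_le_deriv (f := P) (fun x => (hP x).differentiableAt) (C := m)
      (fun x => (hP x).deriv ▸ hP'm x) hz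
    simpa [hP0] using this
  have htpos : ∀ z, 0 < z → 0 < Real.tanh (β * z) := fun z hz => by
    simpa using strictMono_tanh (mul_pos hβ hz)
  have hPc : Continuous P := continuous_iff_continuousAt.2 fun x => (hP x).continuousAt
  set F : ℝ → ℝ := fun z => β * Real.tanh (β * z) * P z - P' z with hF
  have hFc : Continuous F :=
    ((continuous_const.mul (continuous_tanh.comp (continuous_const.mul continuous_id))).mul
      hPc).sub hP'c
  have hiff : ∀ z, 0 < z → (β * Real.tanh (β * z) = P' z / P z ↔ F z = 0) := fun z hz => by
    rw [eq_div_iff (hPpos z hz).ne', hF, sub_eq_zero]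
  have hFmono : ∀ a b, 0 < a → a < b → F a < F b := by
    intro a b ha hab
    have h1 : P' b ≤ P' a := hP'a ha.le (ha.trans hab).le hab.le
    have h2 : Real.tanh (β * a) < Real.tanh (β * b) :=
      strictMono_tanh (mul_lt_mul_of_pos_left hab hβ)
    have h3 : β * Real.tanh (β * a) * P a < β * Real.tanh (β * b) * P b :=
      mul_lt_mul'' (mul_lt_mul_of_pos_left h2 hβ) (hmono hab)
        (mul_pos hβ (htpos a ha)).le (hPpos a ha).le
    simp only [hF]
    linarith
  have hF0 : F 0 < 0 := by
    have := hP'm 0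
    simp only [hF, hP0]
    linarith
  set T := Real.tanh β with hT
  have hT0 : 0 < T := by simpa using htpos 1 one_pos
  set z₁ := max 1 (P' 0 / (β * T * m)) with hz₁
  have hz₁1 : 1 ≤ z₁ := le_max_left _ _
  have hz₁0 : 0 ≤ z₁ := zero_le_one.trans hz₁1
  have hF1 : 0 ≤ F z₁ := by
    have h1 : P' z₁ ≤ P' 0 := hP'a self_mem_Ici hz₁0 hz₁0
    have h2 : T ≤ Real.tanh (β * z₁) := strictMono_tanh.monotone (le_mul_of_one_le_right hβ.le hz₁1)
    have h3 : P' 0 ≤ z₁ * (β * T * m) := (div_le_iff₀ (by positivity)).1 (le_max_right _ _)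
    have h4 : β * T * (m * z₁) ≤ β * Real.tanh (β * z₁) * P z₁ :=
      mul_le_mul (mul_le_mul_of_nonneg_left h2 hβ.le) (hgrow z₁ hz₁0) (by positivity)
        (mul_nonneg hβ.le (hT0.le.trans h2))
    simp only [hF]
    linarith
  obtain ⟨z, hz, hFz⟩ := intermediate_value_Icc hz₁0 hFc.continuousOn ⟨hF0.le, hF1⟩
  have hz0 : 0 < z := lt_of_le_of_ne hz.1 (by rintro rfl; exact hF0.ne hFz)
  refine ⟨z, ⟨hz0, (hiff z hz0).2 hFz⟩, ?_⟩
  rintro w ⟨hw0, hw⟩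
  have hFw := (hiff w hw0).1 hw
  rcases lt_trichotomy w z with hlt | heq | hgt
  · exact absurd (hFmono w z hw0 hlt) (by rw [hFw, hFz]; exact lt_irrefl _)
  · exact heq
  · exact absurd (hFmono z w hz0 hgt) (by rw [hFw, hFz]; exact lt_irrefl _)

/-- The measure `e^{-αt} dt` on the positive half-line. -/
noncomputable def discountMeasure (α : ℝ) : Measure ℝ :=
  (volume.restrict (Ioi (0 : ℝ))).withDensity fun t => ENNReal.ofReal (Real.exp (-α * t))

lemma integral_discountMeasure (α : ℝ) (g : ℝ → ℝ) :
    ∫ t, g t ∂(discountMeasure α) = ∫ t in Ioi (0 : ℝ), Real.exp (-α * t) * g t := by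
  rw [discountMeasure, integral_withDensity_eq_integral_toReal_smul (by fun_prop) (by simp)]
  simp [ENNReal.toReal_ofReal, Real.exp_nonneg]

lemma isFiniteMeasure_discountMeasure {α : ℝ} (hα : 0 < α) :
    IsFiniteMeasure (discountMeasure α) :=
  isFiniteMeasure_withDensity_ofReal (exp_neg_integrableOn_Ioi 0 hα).hasFiniteIntegral

lemma discountMeasure_univ_pos {α : ℝ} (hα : 0 < α) : 0 < (discountMeasure α).real univ := by
  have h1 := integral_discountMeasure α fun _ => 1
  rw [integral_const, smul_eq_mul, mul_one] at h1
  rw [h1]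
  simp only [mul_one]
  have : NeZero (volume.restrict (Ioi (0 : ℝ))) := ⟨by simp⟩
  exact integral_exp_pos (exp_neg_integrableOn_Ioi 0 hα)

lemma integrable_id_discountMeasure {α : ℝ} (hα : 0 < α) :
    Integrable (fun t : ℝ => t) (discountMeasure α) := by
  rw [discountMeasure, integrable_withDensity_iff_integrable_smul' (by fun_prop) (by simp)]
  have := integrableOn_rpow_mul_exp_neg_mul_rpow (p := 1) (s := 1) (b := α) (by norm_num)
    one_pos hα
  simp only [Real.rpow_one] at this
  refine this.congr (Eventually.of_forall fun t => ?_)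
  simp [ENNReal.toReal_ofReal, Real.exp_nonneg, mul_comm]

lemma ae_pos_discountMeasure (α : ℝ) : ∀ᵐ t ∂(discountMeasure α), 0 < t :=
  (withDensity_absolutelyContinuous _ _).ae_le (ae_restrict_mem measurableSet_Ioi)

section DiscountedGaussian

variable {α c : ℝ}

/-- The law of `(t, z)` with `t` weighted by `e^{-αt}` and `z` standard Gaussian. -/
noncomputable def discountGaussian (α : ℝ) : Measure (ℝ × ℝ) :=
  (discountMeasure α).prod (gaussianReal 0 1)

/-- The Gaussian displacement `√(c t) z` of variance `c t`. -/
noncomputable def displacement (c : ℝ) (ω : ℝ × ℝ) : ℝ := √(c * ω.1) * ω.2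

lemma measurable_displacement : Measurable (displacement c) := by
  unfold displacement
  fun_prop

lemma isFiniteMeasure_discountGaussian (hα : 0 < α) : IsFiniteMeasure (discountGaussian α) := by
  have := isFiniteMeasure_discountMeasure hα
  unfold discountGaussian
  infer_instance

lemma discountGaussian_univ_pos (hα : 0 < α) : 0 < (discountGaussian α).real univ := by
  have := isFiniteMeasure_discountMeasure hα
  have h := discountMeasure_univ_pos hα
  rw [discountGaussian, ← univ_prod_univ, measureReal_prod_prod]
  simpa using h

lemma memLp_two_displacement (hα : 0 < α) : MemLp (displacement c) 2 (discountGaussian α) := by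
  have := isFiniteMeasure_discountMeasure hα
  rw [memLp_two_iff_integrable_sq measurable_displacement.aestronglyMeasurable]
  have h1 : Integrable (fun t : ℝ => √(c * t) ^ 2) (discountMeasure α) := by
    have := ((integrable_id_discountMeasure hα).const_mul c).pos_part
    refine this.congr (Eventually.of_forall fun t => ?_)
    simp only [Real.sq_sqrt']
  have h2 : Integrable (fun z : ℝ => z ^ 2) (gaussianReal 0 1) := by
    simpa using (memLp_id_gaussianReal (μ := 0) (v := 1) 2).integrable_sq
  refine (h1.mul_prod h2).congr (Eventually.of_forall fun ω => ?_)
  simp only [displacement, mul_pow]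

lemma integrable_comp_add_displacement (hα : 0 < α) {f : ℝ → ℝ} (hf : Continuous f) {A B : ℝ}
    (hfb : ∀ y, |f y| ≤ A + B * y ^ 2) (y : ℝ) :
    Integrable (fun ω => f (y + displacement c ω)) (discountGaussian α) := by
  have := isFiniteMeasure_discountGaussian hα
  have h1 : MemLp (fun ω => y + displacement c ω) 2 (discountGaussian α) :=
    (memLp_const y).add (memLp_two_displacement hα)
  refine ((integrable_const A).add (h1.integrable_sq.const_mul B)).mono'
    (hf.measurable.comp (measurable_const.add measurable_displacement)).aestronglyMeasurable
    (Eventually.of_forall fun ω => hfb _)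

lemma integral_comp_add_displacement (hα : 0 < α) (hc : 0 < c) {f : ℝ → ℝ} (hf : Continuous f)
    {A B : ℝ} (hfb : ∀ y, |f y| ≤ A + B * y ^ 2) (y : ℝ) :
    ∫ ω, f (y + displacement c ω) ∂(discountGaussian α)
      = ∫ t, (∫ u, f (y + u) ∂(gaussianReal 0 (c * t).toNNReal)) ∂(discountMeasure α) := by
  have := isFiniteMeasure_discountMeasure hα
  have hint := integrable_comp_add_displacement (c := c) hα hf hfb y
  rw [discountGaussian] at hint ⊢
  rw [integral_prod _ hint]
  refine integral_congr_ae ?_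
  filter_upwards [ae_pos_discountMeasure α] with t ht
  rw [integral_gaussianReal_eq_integral_standard (mul_pos hc ht).le
    (f := fun u => f (y + u)) (by fun_prop)]
  rfl

lemma pN_eq_integral_displacement {N : ℕ} (hN : 2 ≤ N) (hα : 0 < α) {h : ℝ → ℝ}
    (hh : Continuous h) {A B : ℝ} (hb : ∀ y, |h y| ≤ A + B * y ^ 2) (x : ℝ) :
    pN N α h x = ∫ ω, h (((N : ℝ) - 1) / N * x + displacement (((N : ℝ) - 1) / N) ω)
      ∂(discountGaussian α) := by
  have hN' : (2 : ℝ) ≤ N := by exact_mod_cast hN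
  rw [integral_comp_add_displacement hα (div_pos (by linarith) (by linarith)) hh hb,
    integral_discountMeasure]
  rfl

lemma antitoneOn_integral_displacement (hα : 0 < α) (hc : 0 < c) {H : ℝ → ℝ} (hHc : Continuous H)
    {C : ℝ} (hC : ∀ y, |H y| ≤ C) (heven : ∀ y, H (-y) = H y) (hanti : AntitoneOn H (Ici 0)) :
    AntitoneOn (fun y => ∫ ω, H (y + displacement c ω) ∂(discountGaussian α)) (Ici 0) := by
  have := isFiniteMeasure_discountMeasure hα
  have hC' : ∀ y, |H y| ≤ C + 0 * y ^ 2 := by simpa using hC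
  have hint : ∀ y, Integrable (fun t => ∫ u, H (y + u) ∂(gaussianReal 0 (c * t).toNNReal))
      (discountMeasure α) := fun y => by
    have := (integrable_comp_add_displacement (c := c) hα hHc hC' y).integral_prod_left
    refine this.congr ?_
    filter_upwards [ae_pos_discountMeasure α] with t ht
    rw [integral_gaussianReal_eq_integral_standard (mul_pos hc ht).le
      (f := fun u => H (y + u)) (by fun_prop)]
    rfl
  intro a ha b hb hab
  simp only [integral_comp_add_displacement hα hc hHc hC']
  exact integral_mono (hint b) (hint a) fun t =>
    antitoneOn_integral_gaussianReal hHc hC heven hanti _ ha hb hab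

end DiscountedGaussian

/-- Under H2', the free-boundary intercept equation
`β tanh(β z) = p_N''(z)/p_N'(z)` with `β = √(2(N−1)α/N)` has a unique positive root. -/
theorem intercept_equation_unique_root (N : ℕ) (hN : 2 ≤ N) (α k K : ℝ)
    (hα : 0 < α) (hk : 0 < k) (hkK : k < K) (h : ℝ → ℝ) (hC2 : ContDiff ℝ 2 h)
    (heven : ∀ x, h (-x) = h x) (h0 : 0 ≤ h 0)
    (hmono : AntitoneOn (deriv (deriv h)) (Set.Ici 0))
    (hlb : ∀ x, k ≤ deriv (deriv h) x) (hub : ∀ x, deriv (deriv h) x ≤ K)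
    (β : ℝ) (hβ : β = Real.sqrt (2 * ((N:ℝ) - 1) * α / N)) :
    ∃! z : ℝ, 0 < z ∧
      β * Real.tanh (β * z) = deriv (deriv (pN N α h)) z / deriv (pN N α h) z := by
  have hN' : (2 : ℝ) ≤ N := by exact_mod_cast hN
  have hβ0 : 0 < β := by
    rw [hβ]
    exact Real.sqrt_pos.2 (div_pos (mul_pos (by linarith) hα) (by linarith))
  have hc : 0 < ((N : ℝ) - 1) / N := div_pos (by linarith) (by linarith)
  have hfin := isFiniteMeasure_discountGaussian hα
  have hdC1 : ContDiff ℝ 1 (deriv h) := hC2.deriv' (n := 1)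
  have hHc : Continuous (deriv (deriv h)) := hdC1.continuous_deriv le_rfl
  have hd_odd : ∀ x, deriv h (-x) = -deriv h x := fun x => by
    have := deriv_comp_neg h x
    simp only [heven] at this
    linarith
  have hH_even : ∀ x, deriv (deriv h) (-x) = deriv (deriv h) x := fun x => by
    have h1 := deriv_comp_neg (deriv h) x
    simp only [hd_odd, deriv.fun_neg] at h1
    linarith
  have hHK : ∀ x, |deriv (deriv h) x| ≤ K := fun x =>
    abs_le.2 ⟨by linarith [hlb x], hub x⟩
  have hd0 : deriv h 0 = 0 := by
    have := hd_odd 0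
    rw [neg_zero] at this
    linarith
  have hd_le : ∀ x, |deriv h x| ≤ K * |x| := fun x => by
    simpa [hd0] using abs_le_mul_abs_of_abs_deriv_le (hdC1.differentiable one_ne_zero)
      (fun y _ => hHK y) (le_refl |x|)
  have hh_le : ∀ y, |h y| ≤ |h 0| + K * y ^ 2 := fun y => by
    have h1 := abs_le_mul_abs_of_abs_deriv_le (hC2.differentiable two_ne_zero) (K := K * |y|)
      (fun x hx => (hd_le x).trans (mul_le_mul_of_nonneg_left hx (hk.trans hkK).le)) (le_refl |y|)
    rw [mul_assoc, ← sq, sq_abs] at h1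
    linarith [abs_sub_abs_le_abs_sub (h y) (h 0)]
  have hd_le' : ∀ y, |deriv h y| ≤ K + K * y ^ 2 := fun y => by
    refine (hd_le y).trans ?_
    nlinarith [sq_nonneg (|y| - 1), sq_abs y, abs_nonneg y]
  have hX := measurable_displacement (c := ((N : ℝ) - 1) / N)
  have hXi := (memLp_two_displacement (c := ((N : ℝ) - 1) / N) hα).integrable one_le_two
  have hH_int := integrable_comp_add_displacement (c := ((N : ℝ) - 1) / N) hα hHc (A := K) (B := 0)
    (by simpa using hHK)
  have hpN := pN_eq_integral_displacement hN hα hC2.continuous hh_le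
  have hpN_even : ∀ x, pN N α h (-x) = pN N α h x := fun x => by
    simp only [pN, mul_neg, integral_gaussianReal_neg_add hC2.continuous heven]
  set c := ((N : ℝ) - 1) / N with hcdef
  set ρ := discountGaussian α with hρ
  set X := displacement c with hXdef
  have hq := hasDerivAt_integral_comp_add hX hXi (hC2.of_le one_le_two) (A := K)
    (fun y => (hd_le y).trans (by nlinarith))
    (integrable_comp_add_displacement hα hC2.continuous hh_le)
  have hq' := hasDerivAt_integral_comp_add hX hXi hdC1 (A := K)
    (fun y => (hHK y).trans (by nlinarith [abs_nonneg y]))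
    (integrable_comp_add_displacement hα hdC1.continuous hd_le')
  have hP : deriv (pN N α h) = fun x => c * ∫ ω, deriv h (c * x + X ω) ∂ρ := by
    rw [funext hpN]
    funext x
    rw [deriv_comp_mul_left c (fun y => ∫ ω, h (y + X ω) ∂ρ), (hq _).deriv, smul_eq_mul]
  have hP' : ∀ x, HasDerivAt (deriv (pN N α h))
      (c * ((∫ ω, deriv (deriv h) (c * x + X ω) ∂ρ) * c)) x := fun x => by
    rw [hP]
    have h1 : HasDerivAt (fun x => c * x) c x := by simpa using (hasDerivAt_id x).const_mul c
    exact ((hq' (c * x)).comp x h1).const_mul c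
  have hP'' : deriv (deriv (pN N α h))
      = fun x => c * ((∫ ω, deriv (deriv h) (c * x + X ω) ∂ρ) * c) :=
    funext fun x => (hP' x).deriv
  refine existsUnique_tanh_eq_deriv_div (m := c * (ρ.real univ * k * c)) hβ0 ?_ (fun x => ?_) ?_
    ?_ (fun x => ?_) ?_
  · have := discountGaussian_univ_pos hα
    positivity
  · rw [hP'']
    exact hP' x
  · have := deriv_comp_neg (pN N α h) 0
    simp only [hpN_even, neg_zero] at this
    linarith
  · rw [hP'']
    have : Continuous fun x => ∫ ω, deriv (deriv h) (c * x + X ω) ∂ρ :=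
      continuous_of_dominated (bound := fun _ => K) (fun x => (hH_int _).aestronglyMeasurable)
        (fun x => Eventually.of_forall fun ω => hHK _) (integrable_const K)
        (Eventually.of_forall fun ω => by fun_prop)
    fun_prop
  · rw [hP'']
    have h1 : ρ.real univ * k ≤ ∫ ω, deriv (deriv h) (c * x + X ω) ∂ρ := by
      simpa using integral_mono (integrable_const k) (hH_int (c * x)) fun ω => hlb _
    simp only
    gcongr
  · rw [hP'']
    intro a ha b hb hab
    have h1 := antitoneOn_integral_displacement hα hc hHc hHK hH_even hmono
      (mul_nonneg hc.le ha : c * a ∈ Ici 0) (mul_nonneg hc.le hb : c * b ∈ Ici 0)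
      (mul_le_mul_of_nonneg_left hab hc.le)
    exact mul_le_mul_of_nonneg_left (mul_le_mul_of_nonneg_right h1 hc.le) hc.le
end

section
/- Define Â : [0,∞) → ℝ by Â(x) := p_N'(x)·(1/β)·sinh(β·x) − p_N''(x)·(1/β²)·cosh(β·x), where β = √(2(N−1)α/N). Then Â is monotone non-decreasing on [0,∞), and Â(0) = −p_N''(0)/β² < 0. -/
open MeasureTheory Real Set Filter Topology ProbabilityTheory

/-- Differentiation under the integral sign along affine lines, for a `C¹` integrand `g` such that
`g` and its derivative grow at most quadratically. -/
theorem hasDerivAt_integral_mul_comp_affine {Ω : Type*} [MeasurableSpace Ω] {μ : Measure Ω}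
    {w A B : Ω → ℝ} (hw : Measurable w) (hA : Measurable A) (hB : Measurable B)
    (hint : Integrable (fun ω => |w ω| * ((1 + A ω ^ 2 + B ω ^ 2) * (1 + |B ω|))) μ)
    {g g' : ℝ → ℝ} {D : ℝ} (hg : ∀ x, HasDerivAt g (g' x) x) (hg'c : Continuous g')
    (hgD : ∀ x, |g x| ≤ D * (1 + x ^ 2)) (hg'D : ∀ x, |g' x| ≤ D * (1 + x ^ 2)) (r : ℝ) :
    HasDerivAt (fun r => ∫ ω, w ω * g (A ω + r * B ω) ∂μ)
      (∫ ω, w ω * (g' (A ω + r * B ω) * B ω) ∂μ) r := by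
  have hgc : Continuous g := continuous_iff_continuousAt.2 fun x => (hg x).continuousAt
  have hD : 0 ≤ D := by simpa using (abs_nonneg _).trans (hgD 0)
  have key : ∀ (f : ℝ → ℝ), (∀ x, |f x| ≤ D * (1 + x ^ 2)) → ∀ s R a b : ℝ, |s| ≤ R →
      |f (a + s * b)| ≤ D * (2 + 2 * R ^ 2) * (1 + a ^ 2 + b ^ 2) := by
    intro f hf s R a b hs
    have hs2 : s ^ 2 ≤ R ^ 2 := sq_le_sq' (by linarith [neg_abs_le s]) (by linarith [le_abs_self s])
    have h1 : 1 + (a + s * b) ^ 2 ≤ (2 + 2 * R ^ 2) * (1 + a ^ 2 + b ^ 2) := by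
      nlinarith [sq_nonneg (a - s * b), mul_nonneg (sub_nonneg.2 hs2) (sq_nonneg b),
        sq_nonneg a, sq_nonneg b, mul_nonneg (sq_nonneg R) (sq_nonneg a), sq_nonneg R]
    calc |f (a + s * b)| ≤ D * (1 + (a + s * b) ^ 2) := hf _
      _ ≤ D * ((2 + 2 * R ^ 2) * (1 + a ^ 2 + b ^ 2)) := by gcongr
      _ = _ := by ring
  refine (hasDerivAt_integral_of_dominated_loc_of_deriv_le
    (bound := fun ω => D * (2 + 2 * (|r| + 1) ^ 2) *
      (|w ω| * ((1 + A ω ^ 2 + B ω ^ 2) * (1 + |B ω|))))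
    (F' := fun r ω => w ω * (g' (A ω + r * B ω) * B ω)) (Metric.ball_mem_nhds r one_pos)
    (.of_forall fun s => ?_) ?_ ?_ (.of_forall fun ω s hs => ?_) (hint.const_mul _)
    (.of_forall fun ω s _ => ?_)).2
  · exact (hw.mul (hgc.measurable.comp (hA.add (hB.const_mul s)))).aestronglyMeasurable
  · refine (hint.const_mul (D * (2 + 2 * |r| ^ 2))).mono'
      (hw.mul (hgc.measurable.comp (hA.add (hB.const_mul r)))).aestronglyMeasurable
      (.of_forall fun ω => ?_)
    rw [norm_mul, Real.norm_eq_abs, Real.norm_eq_abs]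
    calc |w ω| * |g (A ω + r * B ω)|
        ≤ |w ω| * (D * (2 + 2 * |r| ^ 2) * (1 + A ω ^ 2 + B ω ^ 2) * 1) := by
          rw [mul_one]; gcongr; exact key g hgD _ _ _ _ le_rfl
      _ ≤ |w ω| * (D * (2 + 2 * |r| ^ 2) * (1 + A ω ^ 2 + B ω ^ 2) * (1 + |B ω|)) := by
          gcongr; linarith [abs_nonneg (B ω)]
      _ = _ := by ring
  · exact (hw.mul ((hg'c.measurable.comp
      (hA.add (hB.const_mul r))).mul hB)).aestronglyMeasurable
  · have hs' : |s| ≤ |r| + 1 := by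
      rw [Metric.mem_ball, Real.dist_eq] at hs
      linarith [abs_sub_abs_le_abs_sub s r]
    rw [norm_mul, norm_mul, Real.norm_eq_abs, Real.norm_eq_abs, Real.norm_eq_abs]
    calc |w ω| * (|g' (A ω + s * B ω)| * |B ω|)
        ≤ |w ω| * (D * (2 + 2 * (|r| + 1) ^ 2) * (1 + A ω ^ 2 + B ω ^ 2) * (1 + |B ω|)) := by
          gcongr
          · exact key g' hg'D _ _ _ _ hs'
          · linarith
      _ = _ := by ring
  · have h1 : HasDerivAt (fun s => A ω + s * B ω) (B ω) s := by
      simpa using ((hasDerivAt_id s).mul_const (B ω)).const_add (A ω)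
    exact ((hg _).comp s h1).const_mul (w ω)

theorem integrable_abs_pow_gaussianReal (n : ℕ) :
    Integrable (fun z : ℝ => |z| ^ n) (gaussianReal 0 1) := by
  have := (memLp_id_gaussianReal (μ := 0) (v := 1) (n : NNReal)).integrable_norm_pow'
  simpa using this

theorem integrable_sq_gaussianReal : Integrable (fun z : ℝ => z ^ 2) (gaussianReal 0 1) := by
  simpa using integrable_abs_pow_gaussianReal 2

theorem integrable_gaussianPDFReal_mul_iff {f : ℝ → ℝ} :
    Integrable (fun x => gaussianPDFReal 0 1 x * f x) ↔ Integrable f (gaussianReal 0 1) := by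
  rw [gaussianReal_of_var_ne_zero _ one_ne_zero,
    integrable_withDensity_iff_integrable_smul' (measurable_gaussianPDF _ _)
      (.of_forall fun _ => gaussianPDF_lt_top)]
  simp [toReal_gaussianPDF]

theorem hasDerivAt_gaussianPDFReal (x : ℝ) :
    HasDerivAt (gaussianPDFReal 0 1) (-x * gaussianPDFReal 0 1 x) x := by
  have h1 : HasDerivAt (fun x : ℝ => -(x - 0) ^ 2 / (2 * ((1 : NNReal) : ℝ))) (-x) x := by
    have := (((hasDerivAt_id x).sub_const 0).pow 2).neg.div_const (2 * ((1 : NNReal) : ℝ))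
    exact this.congr_deriv (by simp; ring)
  rw [gaussianPDFReal_def]
  exact (h1.exp.const_mul _).congr_deriv (by ring)

/-- Stein's identity for the standard Gaussian measure. -/
theorem integral_id_mul_gaussianReal {g g' : ℝ → ℝ} (hg : ∀ x, HasDerivAt g (g' x) x)
    (hgi : Integrable g (gaussianReal 0 1))
    (hxg : Integrable (fun x => x * g x) (gaussianReal 0 1))
    (hg'i : Integrable g' (gaussianReal 0 1)) :
    ∫ z, z * g z ∂(gaussianReal 0 1) = ∫ z, g' z ∂(gaussianReal 0 1) := by
  rw [integral_gaussianReal_eq_integral_smul one_ne_zero,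
    integral_gaussianReal_eq_integral_smul one_ne_zero]
  have h1 := integral_mul_deriv_eq_deriv_mul_of_integrable (u := gaussianPDFReal 0 1)
    (u' := fun x => -x * gaussianPDFReal 0 1 x) (v := g) (v' := g')
    (fun x _ => hasDerivAt_gaussianPDFReal x) (fun x _ => hg x)
    (integrable_gaussianPDFReal_mul_iff.2 hg'i)
    (by
      refine (integrable_gaussianPDFReal_mul_iff.2 hxg).neg.congr (.of_forall fun x => ?_)
      simp only [Pi.neg_apply, Pi.mul_apply]
      ring)
    (integrable_gaussianPDFReal_mul_iff.2 hgi)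
  simp only [smul_eq_mul]
  rw [h1, ← integral_neg]
  congr 1
  ext x
  ring

theorem abs_comp_affine_le {g : ℝ → ℝ} {D : ℝ} (hgD : ∀ x, |g x| ≤ D * (1 + x ^ 2)) (y s z : ℝ) :
    |g (y + s * z)| ≤ D * (1 + 2 * y ^ 2 + 2 * s ^ 2 * z ^ 2) := by
  have hD : 0 ≤ D := by simpa using (abs_nonneg _).trans (hgD 0)
  refine (hgD _).trans (mul_le_mul_of_nonneg_left ?_ hD)
  nlinarith [sq_nonneg (y - s * z)]

theorem integrable_comp_affine_gaussianReal {g : ℝ → ℝ} {D : ℝ} (hgc : Measurable g)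
    (hgD : ∀ x, |g x| ≤ D * (1 + x ^ 2)) (y s : ℝ) :
    Integrable (fun z => g (y + s * z)) (gaussianReal 0 1) := by
  refine ((((integrable_const (1 + 2 * y ^ 2)).add
    (integrable_sq_gaussianReal.const_mul (2 * s ^ 2))).const_mul D)).mono'
    (hgc.comp (by fun_prop)).aestronglyMeasurable (.of_forall fun z => ?_)
  simpa using abs_comp_affine_le hgD y s z

/-- The heat equation for `s ↦ E[g (y + s Z)]` with `Z` standard Gaussian. -/
theorem hasDerivAt_integral_gaussianReal_scale {g g' g'' : ℝ → ℝ} {D : ℝ}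
    (hg : ∀ x, HasDerivAt g (g' x) x) (hg' : ∀ x, HasDerivAt g' (g'' x) x)
    (hg''c : Measurable g'') (hgD : ∀ x, |g x| ≤ D * (1 + x ^ 2))
    (hg'D : ∀ x, |g' x| ≤ D * (1 + x ^ 2)) (hg''D : ∀ x, |g'' x| ≤ D * (1 + x ^ 2)) (y s : ℝ) :
    HasDerivAt (fun s => ∫ z, g (y + s * z) ∂(gaussianReal 0 1))
      (s * ∫ z, g'' (y + s * z) ∂(gaussianReal 0 1)) s := by
  have hg'c : Continuous g' := continuous_iff_continuousAt.2 fun x => (hg' x).continuousAt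
  have hint : Integrable (fun z : ℝ => |(1 : ℝ)| * ((1 + y ^ 2 + z ^ 2) * (1 + |z|)))
      (gaussianReal 0 1) := by
    have := (((integrable_const (1 + y ^ 2)).add
      ((integrable_abs_pow_gaussianReal 1).const_mul (1 + y ^ 2))).add
      (integrable_abs_pow_gaussianReal 2)).add (integrable_abs_pow_gaussianReal 3)
    refine this.congr (.of_forall fun z => ?_)
    simp only [Pi.add_apply, abs_one, ← sq_abs z]
    ring
  have h1 := hasDerivAt_integral_mul_comp_affine (w := fun _ => (1 : ℝ)) (A := fun _ : ℝ => y)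
    (B := fun z => z) measurable_const measurable_const measurable_id hint hg hg'c hgD hg'D s
  simp only [one_mul] at h1
  convert h1 using 1
  rw [← integral_const_mul]
  have h2 : ∀ z, HasDerivAt (fun z => g' (y + s * z)) (s * g'' (y + s * z)) z := fun z => by
    have h3 : HasDerivAt (fun z => y + s * z) s z := by
      simpa using ((hasDerivAt_id z).const_mul s).const_add y
    exact ((hg' _).comp z h3).congr_deriv (mul_comm _ _)
  rw [← integral_id_mul_gaussianReal h2 (integrable_comp_affine_gaussianReal hg'c.measurable hg'D y s)
    _ ((integrable_comp_affine_gaussianReal hg''c hg''D y s).const_mul s)]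
  · simp only [mul_comm]
  · refine (hint.const_mul (D * (2 + 2 * s ^ 2))).mono'
      (by have := hg'c.measurable; fun_prop) (.of_forall fun z => ?_)
    have hD : 0 ≤ D := by simpa using (abs_nonneg _).trans (hgD 0)
    rw [norm_mul, Real.norm_eq_abs, Real.norm_eq_abs]
    calc |z| * |g' (y + s * z)| ≤ (1 + |z|) * (D * (1 + 2 * y ^ 2 + 2 * s ^ 2 * z ^ 2)) := by
          gcongr
          · linarith
          · exact abs_comp_affine_le hg'D y s z
      _ ≤ (1 + |z|) * (D * ((2 + 2 * s ^ 2) * (1 + y ^ 2 + z ^ 2))) := by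
          gcongr
          nlinarith [mul_nonneg (sq_nonneg s) (sq_nonneg y), sq_nonneg s, sq_nonneg z]
      _ = _ := by rw [abs_one]; ring

/-- The discounted Gaussian expectation of `g` started at `y`, with variance growing at rate `c`. -/
noncomputable def gaussianResolvent (α c : ℝ) (g : ℝ → ℝ) (y : ℝ) : ℝ :=
  ∫ q : ℝ × ℝ, Real.exp (-α * q.1) * g (√(c * q.1) * q.2 + y * 1)
    ∂((volume.restrict (Ioi (0 : ℝ))).prod (gaussianReal 0 1))

section Resolvent

variable {α c : ℝ}

theorem integrable_exp_mul_id (hα : 0 < α) :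
    IntegrableOn (fun t : ℝ => Real.exp (-α * t) * t) (Ioi 0) := by
  have := integrableOn_rpow_mul_exp_neg_mul_rpow (p := 1) (s := 1) (b := α) (by norm_num) one_pos hα
  refine this.congr_fun (fun t _ => ?_) measurableSet_Ioi
  simp [mul_comm]

theorem integrable_resolvent_weight (hα : 0 < α) (hc : 0 ≤ c) (a b : ℝ) :
    Integrable (fun q : ℝ × ℝ => Real.exp (-α * q.1) * (a + b * (√(c * q.1) * q.2) ^ 2))
      ((volume.restrict (Ioi (0 : ℝ))).prod (gaussianReal 0 1)) := by
  have h0 : IntegrableOn (fun t : ℝ => Real.exp (-α * t)) (Ioi 0) :=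
    integrableOn_exp_mul_Ioi (neg_lt_zero.2 hα) 0
  have h1 := Integrable.mul_prod (L := ℝ) h0 (integrable_const a (μ := gaussianReal 0 1))
  have h2 := Integrable.mul_prod (L := ℝ) (integrable_exp_mul_id hα)
    (integrable_sq_gaussianReal.const_mul (b * c))
  refine (h1.add h2).congr ?_
  have h3 : ∀ᵐ q : ℝ × ℝ ∂((volume.restrict (Ioi (0 : ℝ))).prod (gaussianReal 0 1)), 0 < q.1 :=
    Measure.quasiMeasurePreserving_fst.ae (ae_restrict_mem measurableSet_Ioi)
  filter_upwards [h3] with q hq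
  simp only [Pi.add_apply, mul_pow, Real.sq_sqrt (mul_nonneg hc hq.le)]
  ring

theorem integrable_resolvent (hα : 0 < α) (hc : 0 ≤ c) {g : ℝ → ℝ} {D : ℝ} (hgm : Measurable g)
    (hgD : ∀ x, |g x| ≤ D * (1 + x ^ 2)) (y : ℝ) :
    Integrable (fun q : ℝ × ℝ => Real.exp (-α * q.1) * g (√(c * q.1) * q.2 + y * 1))
      ((volume.restrict (Ioi (0 : ℝ))).prod (gaussianReal 0 1)) := by
  refine (integrable_resolvent_weight hα hc (D * (1 + 2 * y ^ 2)) (D * 2)).mono'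
    (by fun_prop) (.of_forall fun q => ?_)
  rw [norm_mul, Real.norm_eq_abs, Real.norm_eq_abs, abs_exp]
  gcongr
  have := abs_comp_affine_le hgD y 1 (√(c * q.1) * q.2)
  rw [one_mul, add_comm y] at this
  rw [mul_one]
  linarith

theorem gaussianResolvent_eq (hα : 0 < α) (hc : 0 ≤ c) {g : ℝ → ℝ} {D : ℝ} (hgm : Measurable g)
    (hgD : ∀ x, |g x| ≤ D * (1 + x ^ 2)) (y : ℝ) :
    gaussianResolvent α c g y =
      ∫ t in Ioi (0 : ℝ), Real.exp (-α * t) * ∫ z, g (y + √(c * t) * z) ∂(gaussianReal 0 1) := by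
  rw [gaussianResolvent, integral_prod _ (integrable_resolvent hα hc hgm hgD y)]
  simp only [integral_const_mul, mul_one, add_comm]

theorem integrableOn_exp_mul_integral (hα : 0 < α) (hc : 0 ≤ c) {g : ℝ → ℝ} {D : ℝ}
    (hgm : Measurable g) (hgD : ∀ x, |g x| ≤ D * (1 + x ^ 2)) (y : ℝ) :
    IntegrableOn
      (fun t => Real.exp (-α * t) * ∫ z, g (y + √(c * t) * z) ∂(gaussianReal 0 1)) (Ioi 0) := by
  have := (integrable_resolvent hα hc hgm hgD y).integral_prod_left
  simp only [integral_const_mul, mul_one, add_comm _ y] at this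
  exact this

theorem hasDerivAt_gaussianResolvent (hα : 0 < α) (hc : 0 ≤ c) {g g' : ℝ → ℝ} {D : ℝ}
    (hg : ∀ x, HasDerivAt g (g' x) x) (hg'c : Continuous g')
    (hgD : ∀ x, |g x| ≤ D * (1 + x ^ 2)) (hg'D : ∀ x, |g' x| ≤ D * (1 + x ^ 2)) (y : ℝ) :
    HasDerivAt (gaussianResolvent α c g) (gaussianResolvent α c g' y) y := by
  have h1 := hasDerivAt_integral_mul_comp_affine
    (μ := (volume.restrict (Ioi (0 : ℝ))).prod (gaussianReal 0 1))
    (w := fun q : ℝ × ℝ => Real.exp (-α * q.1)) (A := fun q => √(c * q.1) * q.2)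
    (B := fun _ => 1) (by fun_prop) (by fun_prop) (by fun_prop)
    ((integrable_resolvent_weight hα hc 4 2).congr (.of_forall fun q => by
      simp only [abs_exp, abs_one]; ring)) hg hg'c hgD hg'D y
  simp only [gaussianResolvent]
  exact h1.congr_deriv (by simp only [mul_one])

/-- The resolvent equation `α R g = g + (c / 2) R g''`. -/
theorem mul_gaussianResolvent_eq (hα : 0 < α) (hc : 0 < c) {g g' g'' : ℝ → ℝ} {D : ℝ}
    (hg : ∀ x, HasDerivAt g (g' x) x) (hg' : ∀ x, HasDerivAt g' (g'' x) x)
    (hg''c : Measurable g'') (hgD : ∀ x, |g x| ≤ D * (1 + x ^ 2))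
    (hg'D : ∀ x, |g' x| ≤ D * (1 + x ^ 2)) (hg''D : ∀ x, |g'' x| ≤ D * (1 + x ^ 2)) (y : ℝ) :
    α * gaussianResolvent α c g y = g y + c / 2 * gaussianResolvent α c g'' y := by
  have hgc : Continuous g := continuous_iff_continuousAt.2 fun x => (hg x).continuousAt
  set Φ : ℝ → ℝ := fun s => ∫ z, g (y + s * z) ∂(gaussianReal 0 1) with hΦ
  set Ψ : ℝ → ℝ := fun s => ∫ z, g'' (y + s * z) ∂(gaussianReal 0 1)
  have hΦd : ∀ s, HasDerivAt Φ (s * Ψ s) s :=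
    hasDerivAt_integral_gaussianReal_scale hg hg' hg''c hgD hg'D hg''D y
  have hΦc : Continuous Φ := continuous_iff_continuousAt.2 fun x => (hΦd x).continuousAt
  have I0 := integrableOn_exp_mul_integral hα hc.le hgc.measurable hgD y
  have I2 := integrableOn_exp_mul_integral hα hc.le hg''c hg''D y
  have hd : ∀ t ∈ Ioi (0 : ℝ), HasDerivAt (fun t => Real.exp (-α * t) * Φ √(c * t))
      (c / 2 * (Real.exp (-α * t) * Ψ √(c * t)) - α * (Real.exp (-α * t) * Φ √(c * t))) t := by
    intro t ht
    have hct : 0 < c * t := mul_pos hc ht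
    have h1 : HasDerivAt (fun t => √(c * t)) (c / (2 * √(c * t))) t := by
      have := ((hasDerivAt_id t).const_mul c).sqrt (by simpa using hct.ne')
      simpa using this
    have h2 : HasDerivAt (fun t => Real.exp (-α * t)) (Real.exp (-α * t) * -α) t := by
      simpa using ((hasDerivAt_id t).const_mul (-α)).exp
    refine (h2.mul ((hΦd _).comp t h1)).congr_deriv ?_
    have : √(c * t) ≠ 0 := (Real.sqrt_pos.2 hct).ne'
    simp only [Function.comp]
    generalize √(c * t) = s at this
    field_simp
    ring
  have hI : IntegrableOn (fun t => c / 2 * (Real.exp (-α * t) * Ψ √(c * t))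
      - α * (Real.exp (-α * t) * Φ √(c * t))) (Ioi 0) := (I2.const_mul _).sub (I0.const_mul _)
  have hlim := tendsto_zero_of_hasDerivAt_of_integrableOn_Ioi hd hI I0
  have hcont : Continuous (fun t => Real.exp (-α * t) * Φ √(c * t)) := by fun_prop
  have := integral_Ioi_of_hasDerivAt_of_tendsto hcont.continuousWithinAt hd hI hlim
  rw [integral_sub (I2.const_mul _) (I0.const_mul _), integral_const_mul, integral_const_mul,
    ← gaussianResolvent_eq hα hc.le hg''c hg''D, ← gaussianResolvent_eq hα hc.le hgc.measurable hgD]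
    at this
  simp [hΦ] at this
  linarith

theorem gaussianResolvent_pos (hα : 0 < α) (hc : 0 ≤ c) {g : ℝ → ℝ} {D k : ℝ} (hk : 0 < k)
    (hgm : Measurable g) (hgD : ∀ x, |g x| ≤ D * (1 + x ^ 2)) (hgk : ∀ x, k ≤ g x) (y : ℝ) :
    0 < gaussianResolvent α c g y := by
  have h0 : IntegrableOn (fun t : ℝ => Real.exp (-α * t)) (Ioi 0) :=
    integrableOn_exp_mul_Ioi (neg_lt_zero.2 hα) 0
  have h1 : ∫ t in Ioi (0 : ℝ), Real.exp (-α * t) * k = k / α := by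
    rw [integral_mul_const, integral_exp_mul_Ioi (neg_lt_zero.2 hα)]
    simp [div_eq_inv_mul]
  rw [gaussianResolvent_eq hα hc hgm hgD]
  refine (div_pos hk hα).trans_le (h1.symm.le.trans ?_)
  refine integral_mono (h0.mul_const k) (integrableOn_exp_mul_integral hα hc hgm hgD y) fun t => ?_
  simp only
  gcongr
  have := integral_mono (integrable_const k)
    (integrable_comp_affine_gaussianReal hgm hgD y √(c * t)) fun z => hgk _
  simpa using this

end Resolvent

theorem integral_gaussianReal_eq_scale {v : ℝ} (hv : 0 ≤ v) {g : ℝ → ℝ} (hg : Measurable g)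
    (y : ℝ) : ∫ u, g (y + u) ∂(gaussianReal 0 v.toNNReal)
      = ∫ z, g (y + √v * z) ∂(gaussianReal 0 1) := by
  have h1 : gaussianReal 0 v.toNNReal = (gaussianReal 0 1).map (√v * ·) := by
    rw [gaussianReal_map_const_mul]
    congr 1
    · simp
    · ext
      simp [Real.sq_sqrt hv, hv]
  rw [h1]
  exact integral_map (by fun_prop) (hg.comp (measurable_const_add y)).aestronglyMeasurable

theorem pN_eq_gaussianResolvent {N : ℕ} (hN : 1 ≤ N) {α : ℝ} (hα : 0 < α) {h : ℝ → ℝ} {D : ℝ}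
    (hm : Measurable h) (hD : ∀ x, |h x| ≤ D * (1 + x ^ 2)) (x : ℝ) :
    pN N α h x = gaussianResolvent α (((N : ℝ) - 1) / N) h (((N : ℝ) - 1) / N * x) := by
  have hN' : (1 : ℝ) ≤ N := by exact_mod_cast hN
  have hc : 0 ≤ ((N : ℝ) - 1) / N := div_nonneg (by linarith) (by linarith)
  rw [gaussianResolvent_eq hα hc hm hD, pN]
  refine setIntegral_congr_fun measurableSet_Ioi fun t ht => ?_
  rw [integral_gaussianReal_eq_scale (mul_nonneg hc (le_of_lt ht)) hm]

/-- A function vanishing at the origin whose derivative is bounded by `C` is bounded by `C |x|`. -/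
theorem abs_le_of_abs_deriv_le {f f' : ℝ → ℝ} {C : ℝ} (hf : ∀ x, HasDerivAt f (f' x) x)
    (hC : ∀ x, |f' x| ≤ C) (h0 : f 0 = 0) (x : ℝ) : |f x| ≤ C * |x| := by
  have := convex_univ.norm_image_sub_le_of_norm_hasDerivWithin_le
    (fun x _ => (hf x).hasDerivWithinAt) (fun x _ => hC x) (mem_univ (0 : ℝ)) (mem_univ x)
  simpa [h0] using this

theorem abs_sub_le_of_abs_deriv_le_linear {f f' : ℝ → ℝ} {C : ℝ}
    (hf : ∀ x, HasDerivAt f (f' x) x) (hC : ∀ x, |f' x| ≤ C * |x|) (x : ℝ) :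
    |f x - f 0| ≤ C * x ^ 2 := by
  have hC0 : 0 ≤ C := by simpa using (abs_nonneg _).trans (hC 1)
  have := (convex_uIcc 0 x).norm_image_sub_le_of_norm_hasDerivWithin_le
    (f := f) (f' := f') (C := C * |x|) (fun z _ => (hf z).hasDerivWithinAt) (fun z hz => ?_)
    left_mem_uIcc right_mem_uIcc
  · rw [Real.norm_eq_abs, Real.norm_eq_abs, sub_zero, mul_assoc, ← sq, sq_abs] at this
    exact this
  · refine (hC z).trans (mul_le_mul_of_nonneg_left ?_ hC0)
    simpa using abs_sub_left_of_mem_uIcc hz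

/-- Under H2', `Â(x) = p_N'(x) (1/β) sinh(βx) − p_N''(x) (1/β²) cosh(βx)` is
monotone non-decreasing on `[0,∞)` and `Â(0) = −p_N''(0)/β² < 0`. -/
theorem A_along_boundary_monotone (N : ℕ) (hN : 2 ≤ N) (α k K : ℝ) (hα : 0 < α)
    (hk : 0 < k) (hkK : k < K) (h : ℝ → ℝ) (hC2 : ContDiff ℝ 2 h)
    (heven : ∀ x, h (-x) = h x) (h0 : 0 ≤ h 0)
    (hmono : AntitoneOn (deriv (deriv h)) (Set.Ici 0))
    (hlb : ∀ x, k ≤ deriv (deriv h) x) (hub : ∀ x, deriv (deriv h) x ≤ K)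
    (β : ℝ) (hβ : β = Real.sqrt (2 * ((N:ℝ) - 1) * α / N))
    (Ahat : ℝ → ℝ)
    (hA : Ahat = fun x => deriv (pN N α h) x * (1 / β) * Real.sinh (β * x)
      - deriv (deriv (pN N α h)) x * (1 / β^2) * Real.cosh (β * x)) :
    MonotoneOn Ahat (Set.Ici 0) ∧
    Ahat 0 = -(deriv (deriv (pN N α h)) 0) / β^2 ∧
    Ahat 0 < 0 := by
  have hd1 : ∀ x, HasDerivAt h (deriv h x) x := fun x =>
    (hC2.differentiable two_ne_zero x).hasDerivAt
  have hC1 : ContDiff ℝ 1 (deriv h) := ((contDiff_succ_iff_deriv (n := 1)).1 hC2).2.2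
  have hd2 : ∀ x, HasDerivAt (deriv h) (deriv (deriv h) x) x := fun x =>
    (hC1.differentiable one_ne_zero x).hasDerivAt
  have hc2 : Continuous (deriv (deriv h)) := hC1.continuous_deriv le_rfl
  have hz : deriv h 0 = 0 := by
    have h1 : (fun x => h (-x)) = h := funext heven
    have h2 := deriv_comp_neg h 0
    rw [h1, neg_zero] at h2
    linarith
  have hK : 0 < K := hk.trans hkK
  have habs2 : ∀ x, |deriv (deriv h) x| ≤ K := fun x =>
    abs_le.2 ⟨by linarith [hlb x], hub x⟩
  have habs1 : ∀ x, |deriv h x| ≤ K * |x| := abs_le_of_abs_deriv_le hd2 habs2 hz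
  have habs0 := abs_sub_le_of_abs_deriv_le_linear hd1 habs1
  set D := K + |h 0| with hDdef
  have hD2 : ∀ x, |deriv (deriv h) x| ≤ D * (1 + x ^ 2) := fun x =>
    (habs2 x).trans (by nlinarith [abs_nonneg (h 0), sq_nonneg x])
  have hD1 : ∀ x, |deriv h x| ≤ D * (1 + x ^ 2) := fun x => by
    have h1 : |x| ≤ 1 + x ^ 2 := by
      rw [← sq_abs]; nlinarith [sq_nonneg (|x| - 1), abs_nonneg x]
    calc |deriv h x| ≤ K * |x| := habs1 x
      _ ≤ D * (1 + x ^ 2) := by gcongr; linarith [abs_nonneg (h 0)]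
  have hD0 : ∀ x, |h x| ≤ D * (1 + x ^ 2) := fun x => by
    have h1 := abs_sub_abs_le_abs_sub (h x) (h 0)
    nlinarith [habs0 x, abs_nonneg (h 0), sq_nonneg x]
  have hN' : (2 : ℝ) ≤ N := by exact_mod_cast hN
  set c : ℝ := ((N : ℝ) - 1) / N with hcdef
  have hc : 0 < c := div_pos (by linarith) (by linarith)
  have hβ2 : β ^ 2 = 2 * c * α := by
    rw [hβ, Real.sq_sqrt]
    · rw [hcdef]; ring
    · exact div_nonneg (mul_nonneg (by linarith) hα.le) (by linarith)
  have hβ0 : β ≠ 0 := by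
    rintro rfl
    have := mul_pos hc hα
    linarith
  have hp : pN N α h = fun x => gaussianResolvent α c h (c * x) :=
    funext (pN_eq_gaussianResolvent (by omega) hα hC2.continuous.measurable hD0)
  have hP : ∀ y, HasDerivAt (gaussianResolvent α c h) (gaussianResolvent α c (deriv h) y) y :=
    hasDerivAt_gaussianResolvent hα hc.le hd1 hC1.continuous hD0 hD1
  have hP1 : ∀ y, HasDerivAt (gaussianResolvent α c (deriv h))
      (gaussianResolvent α c (deriv (deriv h)) y) y :=
    hasDerivAt_gaussianResolvent hα hc.le hd2 hc2 hD1 hD2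
  have hcx : ∀ x, HasDerivAt (fun x => c * x) c x := fun x => by
    simpa using (hasDerivAt_id x).const_mul c
  have hp1 : deriv (pN N α h) = fun x => gaussianResolvent α c (deriv h) (c * x) * c := by
    rw [hp]; exact funext fun x => ((hP _).comp x (hcx x)).deriv
  have hp2' : deriv (deriv (pN N α h)) =
      fun x => gaussianResolvent α c (deriv (deriv h)) (c * x) * c * c := by
    rw [hp1]; exact funext fun x => (((hP1 _).comp x (hcx x)).mul_const c).deriv
  have hres : ∀ y, gaussianResolvent α c (deriv (deriv h)) y
      = 2 / c * (α * gaussianResolvent α c h y - h y) := fun y => by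
    rw [mul_gaussianResolvent_eq hα hc hd1 hd2 hc2.measurable hD0 hD1 hD2 y]
    field_simp
    ring
  have hp2 : deriv (deriv (pN N α h)) =
      fun x => 2 * c * (α * gaussianResolvent α c h (c * x) - h (c * x)) := by
    rw [hp2']; funext x; rw [hres]; field_simp
  have hAd : ∀ x, HasDerivAt Ahat (2 * c ^ 2 / β ^ 2 * deriv h (c * x) * Real.cosh (β * x)) x := by
    intro x
    have hbx : HasDerivAt (fun x => β * x) β x := by
      simpa using (hasDerivAt_id x).const_mul β
    have e1 := (((hP1 _).comp x (hcx x)).mul_const c).mul_const (1 / β) |>.mul hbx.sinh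
    have e2 := (((((hP _).comp x (hcx x)).const_mul α).sub
      ((hd1 _).comp x (hcx x))).const_mul (2 * c)).mul_const (1 / β ^ 2) |>.mul hbx.cosh
    rw [hA, hp2, hp1]
    refine (e1.sub e2).congr_deriv ?_
    simp only [Function.comp, Pi.sub_apply, hres (c * x)]
    have hα' : α = β ^ 2 / (2 * c) := by rw [hβ2]; field_simp
    generalize gaussianResolvent α c h (c * x) = P
    generalize gaussianResolvent α c (deriv h) (c * x) = P1
    rw [hα']
    field_simp
    ring
  have hval : Ahat 0 = -(deriv (deriv (pN N α h)) 0) / β ^ 2 := by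
    rw [hA]; simp; ring
  refine ⟨?_, hval, ?_⟩
  · have hmon1 : Monotone (deriv h) := monotone_of_deriv_nonneg
      (hC1.differentiable one_ne_zero) fun x => hk.le.trans (hlb x)
    refine monotoneOn_of_deriv_nonneg (convex_Ici 0)
      (fun x _ => (hAd x).continuousAt.continuousWithinAt)
      (fun x _ => (hAd x).differentiableAt.differentiableWithinAt) fun x hx => ?_
    rw [interior_Ici] at hx
    have h1 : 0 ≤ deriv h (c * x) := hz ▸ hmon1 (mul_nonneg hc.le (le_of_lt hx))
    rw [(hAd x).deriv]
    have := Real.cosh_pos (β * x)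
    positivity
  · have h1 := gaussianResolvent_pos hα hc.le hk hc2.measurable hD2 hlb (c * 0)
    rw [hval, hp2']
    exact div_neg_of_neg_of_pos (neg_neg_of_pos (by positivity)) (by positivity)
end
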